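/- An infinite random array X = [X_{i,j}]_{i,j≥1} of random variables with values in a Polish space X is separately exchangeable if and only if there exists a measurable function H : [0,1]^4 → X such that X can be coded by i.i.d. Uniform(0,1) independent random variables U; U_i, i≥1; V_j, j≥1; U_{i,j}, i,j≥1, with representing function H; that is, [X_{i,j}]_{i,j≥1} has the same distribution as [X*_{i,j}]_{i,j≥1} where X*_{i,j} = H(U, U_i, V_j, U_{i,j}). -/

import Mathlib

open MeasureTheory ProbabilityTheory Filter Topology
open scoped ENNReal NNReal

/-- An infinite random array `[X_{i,j}]` is separately exchangeable if its joint law is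
invariant under finite permutations acting separately on rows and columns. -/
def SeparatelyExchangeable {Ω 𝕏 : Type*} [MeasurableSpace Ω] [MeasurableSpace 𝕏]
    (μ : Measure Ω) (X : ℕ → ℕ → Ω → 𝕏) : Prop :=
  ∀ σ τ : Equiv.Perm ℕ, {n | σ n ≠ n}.Finite → {n | τ n ≠ n}.Finite →
    Measure.map (fun ω (p : ℕ × ℕ) => X (σ p.1) (τ p.2) ω) μ
      = Measure.map (fun ω (p : ℕ × ℕ) => X p.1 p.2 ω) μ

/-- The Uniform(0,1) distribution on `ℝ`. -/
noncomputable def unif : Measure ℝ := volume.restrict (Set.Icc 0 1)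

instance : IsProbabilityMeasure unif := by
  constructor
  rw [unif, Measure.restrict_apply MeasurableSet.univ, Set.univ_inter, Real.volume_Icc]
  norm_num

/-- If `Y` has the same joint law with the finer variable `G` as with a function of the coarser
variable `F`, then conditioning `Y` on `G` is the same as conditioning on `F`. -/
theorem condExp_ae_eq_of_identDistrib {Ω 𝔽 𝔾 : Type*} {mF mG mΩ : MeasurableSpace Ω}
    [MeasurableSpace 𝔽] [m𝔾 : MeasurableSpace 𝔾] {μ : Measure Ω} [IsProbabilityMeasure μ]
    {F : Ω → 𝔽} {G : Ω → 𝔾} {φ : 𝔽 → 𝔾} (hF : Measurable[mF] F)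
    (hG : mG = MeasurableSpace.comap G m𝔾) (hmG : mG ≤ mΩ) (hφ : Measurable φ) (hFG : mF ≤ mG)
    {Y : Ω → ℝ} (hY : MemLp Y 2 μ)
    (h : IdentDistrib (fun ω => (Y ω, φ (F ω))) (fun ω => (Y ω, G ω)) μ μ) :
    μ[Y | mF] =ᵐ[μ] μ[Y | mG] := by
  have hcomp : ∃ g : 𝔾 → ℝ, Measurable g ∧ μ[Y | mG] = g ∘ G := by
    subst hG
    exact stronglyMeasurable_condExp.measurable.exists_eq_measurable_comp
  obtain ⟨g, hg, hge⟩ := hcomp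
  set u : Ω → ℝ := fun ω => g (φ (F ω))
  set e : Ω → ℝ := μ[Y | mG]
  have huF : StronglyMeasurable[mF] u :=
    ((hg.comp hφ).comp hF).stronglyMeasurable
  have huG : StronglyMeasurable[mG] u := huF.mono hFG
  have heG : StronglyMeasurable[mG] e := stronglyMeasurable_condExp
  have he2 : MemLp e 2 μ := hY.condExp one_le_two
  have hid : IdentDistrib u e μ μ := by
    have := h.comp (hg.comp measurable_snd)
    rw [hge]
    exact this
  have hu2 : MemLp u 2 μ := hid.memLp_iff.2 he2
  have hYu : ∫ ω, Y ω * u ω ∂μ = ∫ ω, Y ω * e ω ∂μ := by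
    have := (h.comp (measurable_fst.mul (hg.comp measurable_snd))).integral_eq
    rw [hge]
    exact this
  have huu : ∫ ω, u ω * u ω ∂μ = ∫ ω, e ω * e ω ∂μ :=
    (hid.comp (measurable_id.mul measurable_id)).integral_eq
  have pull {v : Ω → ℝ} (hv : StronglyMeasurable[mG] v) (hv2 : MemLp v 2 μ) :
      ∫ ω, Y ω * v ω ∂μ = ∫ ω, e ω * v ω ∂μ := by
    have h1 := condExp_mul_of_stronglyMeasurable_right (μ := μ) (f := Y) hv
      (hY.integrable_mul hv2) (hY.integrable one_le_two)
    have h2 := integral_condExp (μ := μ) (f := Y * v) hmG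
    rw [integral_congr_ae h1] at h2
    exact h2.symm
  have heu : e =ᵐ[μ] u := by
    have h0 : ∫ ω, (e ω - u ω) ^ 2 ∂μ = 0 := by
      have : ∀ ω, (e ω - u ω) ^ 2 = e ω * e ω - 2 * (e ω * u ω) + u ω * u ω := fun ω => by ring
      simp_rw [this]
      have i1 : Integrable (fun ω => e ω * e ω) μ := he2.integrable_mul he2
      have i2 : Integrable (fun ω => e ω * u ω) μ := he2.integrable_mul hu2
      have i3 : Integrable (fun ω => u ω * u ω) μ := hu2.integrable_mul hu2
      rw [integral_add (by exact i1.sub (i2.const_mul 2)) i3, integral_sub i1 (i2.const_mul 2),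
        integral_const_mul, ← pull huG hu2, hYu, pull heG he2, huu]
      ring
    rw [integral_eq_zero_iff_of_nonneg (fun ω => sq_nonneg _)
      (by exact (he2.sub hu2).integrable_sq)] at h0
    filter_upwards [h0] with ω hω
    simpa [sub_eq_zero] using hω
  calc μ[Y | mF] =ᵐ[μ] μ[e | mF] := (condExp_condExp_of_le hFG hmG).symm
    _ =ᵐ[μ] μ[u | mF] := condExp_congr_ae heu
    _ = u := condExp_of_stronglyMeasurable (hFG.trans hmG) huF (hu2.integrable one_le_two)
    _ =ᵐ[μ] e := heu.symm

/-- A family of events generating the law of `Y`, each of which has the same joint law with `G` as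
with some function of `F`, lets one replace `Y ∈ s` by its conditional probability given `F` when
integrating against functions of `G`. -/
theorem lintegral_indicator_mul_eq_condDistrib {Ω 𝔽 𝔾 𝕐 : Type*} [MeasurableSpace Ω]
    [MeasurableSpace 𝔽] [MeasurableSpace 𝔾] [m𝕐 : MeasurableSpace 𝕐]
    [StandardBorelSpace 𝕐] [Nonempty 𝕐] {μ : Measure Ω} [IsProbabilityMeasure μ]
    {F : Ω → 𝔽} {G : Ω → 𝔾} {Y : Ω → 𝕐} (hF : Measurable F) (hG : Measurable G) (hY : Measurable Y)
    (hFG : MeasurableSpace.comap F inferInstance ≤ MeasurableSpace.comap G inferInstance)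
    {C : Set (Set 𝕐)} (hC : IsPiSystem C)
    (hgen : m𝕐 = MeasurableSpace.generateFrom C)
    (h : ∀ s ∈ C, ∃ φ : 𝔽 → 𝔾, Measurable φ ∧
      IdentDistrib (fun ω => (s.indicator (1 : 𝕐 → ℝ) (Y ω), φ (F ω)))
        (fun ω => (s.indicator (1 : 𝕐 → ℝ) (Y ω), G ω)) μ μ)
    {s : Set 𝕐} (hs : MeasurableSet s) {Z : Ω → ℝ≥0∞}
    (hZ : Measurable[MeasurableSpace.comap G inferInstance] Z) :
    ∫⁻ ω, s.indicator 1 (Y ω) * Z ω ∂μ = ∫⁻ ω, condDistrib Y F μ (F ω) s * Z ω ∂μ := by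
  have hmG : MeasurableSpace.comap G inferInstance ≤ ‹MeasurableSpace Ω› := hG.comap_le
  have hCm : ∀ s ∈ C, MeasurableSet s := fun s hs => by
    rw [hgen]; exact MeasurableSpace.measurableSet_generateFrom hs
  have hκ {s : Set 𝕐} (hs : MeasurableSet s) :
      Measurable fun ω => condDistrib Y F μ (F ω) s :=
    (Kernel.measurable_coe _ hs).comp hF
  have key {s : Set 𝕐} (hs : s ∈ C) {t : Set Ω}
      (ht : MeasurableSet[MeasurableSpace.comap G inferInstance] t) :
      (μ.restrict t).map Y s = ∫⁻ ω in t, condDistrib Y F μ (F ω) s ∂μ := by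
    obtain ⟨φ, hφ, hid⟩ := h s hs
    have hsm := hCm s hs
    have hind : (fun ω => s.indicator (1 : 𝕐 → ℝ) (Y ω)) = (Y ⁻¹' s).indicator fun _ => 1 := by
      rfl
    have hL : MemLp (fun ω => s.indicator (1 : 𝕐 → ℝ) (Y ω)) 2 μ := by
      rw [hind]
      exact memLp_indicator_const 2 (hY hsm) 1 (Or.inr (measure_ne_top _ _))
    have hce := condExp_ae_eq_of_identDistrib (comap_measurable F) rfl hmG hφ hFG hL hid
    have hcd := condDistrib_ae_eq_condExp (μ := μ) hF hY hsm
    rw [hind] at hce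
    have h1 := setIntegral_condExp (μ := μ) hmG (hL.integrable one_le_two) ht
    rw [hind, setIntegral_indicator (hY hsm)] at h1
    have h2 : ∫ ω in t, (condDistrib Y F μ (F ω)).real s ∂μ = μ.real (t ∩ Y ⁻¹' s) := by
      rw [integral_congr_ae (ae_restrict_of_ae (hcd.trans hce)), h1]
      simp [measureReal_def]
    rw [Measure.map_apply hY hsm, Measure.restrict_apply (hY hsm), Set.inter_comm,
      ← ENNReal.ofReal_toReal (measure_ne_top μ (t ∩ Y ⁻¹' s)), ← measureReal_def, ← h2,
      ofReal_integral_eq_lintegral_ofReal]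
    · simp [measureReal_def]
    · exact (integrable_toReal_condDistrib hF.aemeasurable hsm).integrableOn
    · exact ae_of_all _ fun ω => measureReal_nonneg
  have ext {t : Set Ω} (ht : MeasurableSet[MeasurableSpace.comap G inferInstance] t) :
      (μ.restrict t).map Y = (μ.restrict t).bind fun ω => condDistrib Y F μ (F ω) := by
    have hm : Measurable fun ω => condDistrib Y F μ (F ω) := (Kernel.measurable _).comp hF
    have := Measure.isFiniteMeasure_map (μ.restrict t) Y
    refine ext_of_generate_finite C hgen hC (fun s hs => ?_) ?_
    · rw [key hs ht, Measure.bind_apply (hCm s hs) hm.aemeasurable]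
    · rw [Measure.map_apply hY .univ, Measure.bind_apply .univ hm.aemeasurable]
      simp
  have htrim : (μ.withDensity fun ω => s.indicator 1 (Y ω)).trim hmG
      = (μ.withDensity fun ω => condDistrib Y F μ (F ω) s).trim hmG := by
    refine @Measure.ext _ (MeasurableSpace.comap G inferInstance) _ _ fun t ht => ?_
    have hm : Measurable fun ω => condDistrib Y F μ (F ω) := (Kernel.measurable _).comp hF
    rw [trim_measurableSet_eq hmG ht, trim_measurableSet_eq hmG ht,
      withDensity_apply _ (hmG _ ht), withDensity_apply _ (hmG _ ht),
      ← Measure.bind_apply hs hm.aemeasurable, ← ext ht,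
      ← lintegral_map (measurable_one.indicator hs) hY, lintegral_indicator_one hs]
  have := congrArg (fun ν => @lintegral _ (MeasurableSpace.comap G inferInstance) ν Z) htrim
  simp only [lintegral_trim hmG hZ] at this
  rwa [lintegral_withDensity_eq_lintegral_mul _
      (by exact (measurable_one.indicator hs).comp hY)
      (hZ.mono hmG le_rfl),
    lintegral_withDensity_eq_lintegral_mul _ (hκ hs) (hZ.mono hmG le_rfl)] at this

theorem exists_perm_eq_of_injective {σ : ℕ → ℕ} (hσ : Function.Injective σ) (N : ℕ) :
    ∃ π : Equiv.Perm ℕ, {n | π n ≠ n}.Finite ∧ ∀ i < N, π i = σ i := by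
  induction N with
  | zero => exact ⟨1, by simp, by simp⟩
  | succ N ih =>
    obtain ⟨π, hfin, hπ⟩ := ih
    refine ⟨Equiv.swap (σ N) (π N) * π, ?_, fun i hi => ?_⟩
    · refine (hfin.union (Set.toFinite {π.symm (σ N), N})).subset fun n hn => ?_
      by_contra hcon
      simp only [Set.mem_union, Set.mem_ofPred_eq, Set.mem_insert_iff, Set.mem_singleton_iff,
        not_or, not_not] at hcon
      apply hn
      rw [Equiv.Perm.mul_apply, Equiv.swap_apply_of_ne_of_ne, hcon.1]
      · intro h; exact hcon.2.1 (by rw [← h, Equiv.symm_apply_apply])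
      · intro h; exact hcon.2.2 (π.injective h)
    · rw [Equiv.Perm.mul_apply]
      rcases Nat.lt_succ_iff_lt_or_eq.1 hi with hi | rfl
      · rw [Equiv.swap_apply_of_ne_of_ne, hπ i hi]
        · rw [hπ i hi]; exact hσ.ne hi.ne
        · exact π.injective.ne hi.ne
      · simp

theorem Measure.map_pi_eq_of_forall_finset {Ω Ω' ι 𝕏 : Type*} [MeasurableSpace Ω]
    [MeasurableSpace Ω'] [MeasurableSpace 𝕏] {μ : Measure Ω} {ν : Measure Ω'}
    [IsProbabilityMeasure μ] {X : Ω → ι → 𝕏} {Y : Ω' → ι → 𝕏} (hX : Measurable X)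
    (hY : Measurable Y)
    (h : ∀ I : Finset ι, μ.map (fun ω => I.restrict (X ω)) = ν.map (fun ω => I.restrict (Y ω))) :
    μ.map X = ν.map Y := by
  have (I : Finset ι) : IsProbabilityMeasure (μ.map fun ω => I.restrict (X ω)) :=
    Measure.isProbabilityMeasure_map (by fun_prop)
  refine IsProjectiveLimit.unique
    (P := fun I : Finset ι => μ.map (fun ω => I.restrict (X ω))) ?_ ?_
  · intro I
    rw [Measure.map_map (by fun_prop) hX]; rfl
  · intro I
    rw [Measure.map_map (by fun_prop) hY]; exact (h I).symm

/-- Separate exchangeability implies invariance of the law under arbitrary injections of the row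
and column indices. -/
theorem SeparatelyExchangeable.identDistrib_injective {Ω 𝕏 : Type*} [MeasurableSpace Ω]
    [MeasurableSpace 𝕏] {μ : Measure Ω} [IsProbabilityMeasure μ] {X : ℕ → ℕ → Ω → 𝕏}
    (hX : ∀ i j, Measurable (X i j)) (h : SeparatelyExchangeable μ X) {σ τ : ℕ → ℕ}
    (hσ : Function.Injective σ) (hτ : Function.Injective τ) :
    IdentDistrib (fun ω (p : ℕ × ℕ) => X (σ p.1) (τ p.2) ω) (fun ω (p : ℕ × ℕ) => X p.1 p.2 ω)
      μ μ := by
  have hm (σ τ : ℕ → ℕ) : Measurable fun ω (p : ℕ × ℕ) => X (σ p.1) (τ p.2) ω :=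
    measurable_pi_lambda _ fun p => hX _ _
  refine ⟨(hm σ τ).aemeasurable, (hm id id).aemeasurable, ?_⟩
  refine Measure.map_pi_eq_of_forall_finset (hm σ τ) (hm id id) fun I => ?_
  obtain ⟨N, hN⟩ : ∃ N, ∀ p ∈ I, p.1 < N ∧ p.2 < N := by
    refine ⟨I.sup (fun p => max p.1 p.2) + 1, fun p hp => ?_⟩
    have := Finset.le_sup (f := fun p : ℕ × ℕ => max p.1 p.2) hp
    simp only [sup_le_iff] at this
    omega
  obtain ⟨π, hπf, hπ⟩ := exists_perm_eq_of_injective hσ N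
  obtain ⟨ρ, hρf, hρ⟩ := exists_perm_eq_of_injective hτ N
  have key := congrArg (Measure.map I.restrict) (h π ρ hπf hρf)
  rw [Measure.map_map (by fun_prop) (hm π ρ),
    Measure.map_map (by fun_prop) (by exact hm id id)] at key
  have hσπ : (fun ω => I.restrict fun p : ℕ × ℕ => X (σ p.1) (τ p.2) ω)
      = I.restrict ∘ fun ω (p : ℕ × ℕ) => X (π p.1) (ρ p.2) ω := by
    ext ω p
    simp [hπ _ (hN p p.2).1, hρ _ (hN p p.2).2]
  rw [hσπ]
  exact key

/-- The σ-algebra generated by the entries of `X` with index in `S`. -/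
abbrev entrySigma {Ω 𝕏 : Type*} [MeasurableSpace 𝕏] (X : ℕ → ℕ → Ω → 𝕏) (S : Set (ℕ × ℕ)) :
    MeasurableSpace Ω :=
  MeasurableSpace.comap (fun ω (p : S) => X p.1.1 p.1.2 ω) MeasurableSpace.pi

/-- The sub-array with even row and column indices. -/
def evenBlock {Ω 𝕏 : Type*} (X : ℕ → ℕ → Ω → 𝕏) (ω : Ω) : ℕ × ℕ → 𝕏 :=
  fun p => X (2 * p.1) (2 * p.2) ω

/-- The entries of row `i` with even column index. -/
def rowTrace {Ω 𝕏 : Type*} (X : ℕ → ℕ → Ω → 𝕏) (i : ℕ) (ω : Ω) : ℕ → 𝕏 :=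
  fun j => X i (2 * j) ω

/-- The entries of column `j` with even row index. -/
def colTrace {Ω 𝕏 : Type*} (X : ℕ → ℕ → Ω → 𝕏) (j : ℕ) (ω : Ω) : ℕ → 𝕏 :=
  fun i => X (2 * i) j ω

section Entries

variable {Ω 𝕏 : Type*} [MeasurableSpace 𝕏] {X : ℕ → ℕ → Ω → 𝕏} {S : Set (ℕ × ℕ)}

theorem measurable_entrySigma {i j : ℕ} (h : (i, j) ∈ S) : Measurable[entrySigma X S] (X i j) :=
  (measurable_pi_apply (⟨(i, j), h⟩ : S)).comp
    (comap_measurable fun ω (p : S) => X p.1.1 p.1.2 ω)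

theorem measurable_evenBlock {m : MeasurableSpace Ω}
    (h : ∀ i j, Measurable[m] (X (2 * i) (2 * j))) : Measurable[m] (evenBlock X) :=
  measurable_pi_lambda _ fun p => h p.1 p.2

theorem measurable_rowTrace {m : MeasurableSpace Ω} {i : ℕ}
    (h : ∀ j, Measurable[m] (X i (2 * j))) : Measurable[m] (rowTrace X i) :=
  measurable_pi_lambda _ h

theorem measurable_colTrace {m : MeasurableSpace Ω} {j : ℕ}
    (h : ∀ i, Measurable[m] (X (2 * i) j)) : Measurable[m] (colTrace X j) :=
  measurable_pi_lambda _ h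

theorem entrySigma_transpose (S : Set (ℕ × ℕ)) :
    entrySigma X S ≤ entrySigma (fun i j => X j i) (Prod.swap ⁻¹' S) :=
  Measurable.comap_le <| by
    refine @measurable_pi_lambda _ _ _ (_) _ _ fun p : S => ?_
    exact measurable_entrySigma (X := fun i j => X j i) (i := p.1.2) (j := p.1.1) p.2

end Entries

theorem SeparatelyExchangeable.transpose {Ω 𝕏 : Type*} [MeasurableSpace Ω] [MeasurableSpace 𝕏]
    {μ : Measure Ω} {X : ℕ → ℕ → Ω → 𝕏} (hX : ∀ i j, Measurable (X i j))
    (h : SeparatelyExchangeable μ X) : SeparatelyExchangeable μ fun i j => X j i := by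
  intro σ τ hσ hτ
  have := congrArg (Measure.map fun (x : ℕ × ℕ → 𝕏) (p : ℕ × ℕ) => x (p.2, p.1)) (h τ σ hτ hσ)
  rwa [Measure.map_map (by fun_prop) (measurable_pi_lambda _ fun p => hX _ _),
    Measure.map_map (by fun_prop) (measurable_pi_lambda _ fun p => hX _ _)] at this

section Conditioning

variable {Ω 𝕏 : Type*} [MeasurableSpace Ω] [MeasurableSpace 𝕏] [StandardBorelSpace 𝕏] [Nonempty 𝕏]
  {μ : Measure Ω} [IsProbabilityMeasure μ] {X : ℕ → ℕ → Ω → 𝕏}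

theorem condDistrib_eq_of_identDistrib {α β : Type*} [MeasurableSpace α] [MeasurableSpace β]
    [StandardBorelSpace β] [Nonempty β] {F F' : Ω → α} {Y Y' : Ω → β}
    (h : IdentDistrib (fun ω => (F ω, Y ω)) (fun ω => (F' ω, Y' ω)) μ μ) :
    condDistrib Y F μ = condDistrib Y' F' μ := by
  rw [condDistrib, condDistrib]
  congr 1
  exact h.map_eq

/-- The traces of the odd rows on the even columns are conditionally i.i.d. given the even block,
and each is conditionally independent of all the other rows. -/
theorem SeparatelyExchangeable.exists_rowKernel (hX : ∀ i j, Measurable (X i j))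
    (h : SeparatelyExchangeable μ X) :
    ∃ β : Kernel (ℕ × ℕ → 𝕏) (ℕ → 𝕏), IsMarkovKernel β ∧
      ∀ (k : ℕ) (s : Set (ℕ → 𝕏)) (Z : Ω → ℝ≥0∞), MeasurableSet s →
        Measurable[entrySigma X {p | p.1 ≠ 2 * k + 1}] Z →
        ∫⁻ ω, s.indicator 1 (rowTrace X (2 * k + 1) ω) * Z ω ∂μ
          = ∫⁻ ω, β (evenBlock X ω) s * Z ω ∂μ := by
  refine ⟨condDistrib (rowTrace X 1) (evenBlock X) μ, inferInstance, fun k s Z hs hZ => ?_⟩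
  have hdist : condDistrib (rowTrace X (2 * k + 1)) (evenBlock X) μ
      = condDistrib (rowTrace X 1) (evenBlock X) μ := by
    refine condDistrib_eq_of_identDistrib ?_
    have hid := h.identDistrib_injective (μ := μ) hX
      (σ := fun i => if i % 2 = 0 then i else i + 2 * k) (τ := id)
      (fun a b hab => by dsimp only at hab; split_ifs at hab <;> omega) Function.injective_id
    have := hid.comp (u := fun x : ℕ × ℕ → 𝕏 =>
      ((fun p : ℕ × ℕ => x (2 * p.1, 2 * p.2)), fun j : ℕ => x (1, 2 * j))) (by fun_prop)
    convert this using 1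
    swap
    · rfl
    ext ω : 1
    simp [funext_iff, evenBlock, rowTrace, add_comm]
  rw [← hdist]
  have hmem (i j : ℕ) : (2 * i, j) ∈ {p : ℕ × ℕ | p.1 ≠ 2 * k + 1} := by
    simp only [Set.mem_ofPred_eq]; omega
  refine lintegral_indicator_mul_eq_condDistrib
    (G := fun ω (p : {p : ℕ × ℕ | p.1 ≠ 2 * k + 1}) => X p.1.1 p.1.2 ω)
    (measurable_evenBlock fun _ _ => hX _ _) (measurable_pi_lambda _ fun p => hX _ _)
    (measurable_rowTrace fun _ => hX _ _) ?_ (C := measurableCylinders fun _ : ℕ => 𝕏)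
    isPiSystem_measurableCylinders generateFrom_measurableCylinders.symm (fun c hc => ?_) hs hZ
  · exact (measurable_evenBlock fun i j => measurable_entrySigma (hmem i (2 * j))).comap_le
  · obtain ⟨I, T, hT, rfl⟩ := (mem_measurableCylinders c).1 hc
    have hcm : MeasurableSet (cylinder (α := fun _ => 𝕏) I T) := MeasurableSet.cylinder I hT
    set N := I.sup id + 1 with hN
    have hIN : ∀ i ∈ I, i < N := fun i hi =>
      Nat.lt_succ_of_le (Finset.le_sup (f := id) hi)
    refine ⟨fun a p => a (p.1.1, if p.1.2 % 2 = 0 ∧ p.1.2 < 2 * N then p.1.2 / 2 else p.1.2 + N),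
      by fun_prop, ?_⟩
    have hid := h.identDistrib_injective (μ := μ) hX
      (σ := fun i => if i = 2 * k + 1 then i else 2 * i)
      (τ := fun j => if j % 2 = 0 ∧ j < 2 * N then j else 2 * (j + N))
      (fun a b hab => by dsimp only at hab; split_ifs at hab <;> omega)
      (fun a b hab => by dsimp only at hab; split_ifs at hab <;> omega)
    have := hid.comp (u := fun x : ℕ × ℕ → 𝕏 =>
      ((cylinder I T).indicator (1 : (ℕ → 𝕏) → ℝ) fun j : ℕ => x (2 * k + 1, 2 * j),
        fun p : {p : ℕ × ℕ | p.1 ≠ 2 * k + 1} => x p.1))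
      (((measurable_one.indicator hcm).comp (by fun_prop)).prodMk (by fun_prop))
    convert this using 1
    swap
    · rfl
    ext ω : 1
    refine Prod.ext ?_ ?_
    · have hrestr : rowTrace X (2 * k + 1) ω ∈ cylinder (α := fun _ => 𝕏) I T ↔
          (fun j => X (2 * k + 1) (if 2 * j % 2 = 0 ∧ 2 * j < 2 * N then 2 * j
            else 2 * (2 * j + N)) ω) ∈ cylinder (α := fun _ => 𝕏) I T := by
        rw [mem_cylinder, mem_cylinder]
        refine iff_of_eq (congrArg (· ∈ T) (funext fun i => ?_))
        simp [rowTrace, hIN i i.2]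
      classical
      simp only [Function.comp_def, Set.indicator_apply, Pi.one_apply, if_true, hrestr]
    · refine funext fun p => ?_
      have hp : p.1.1 ≠ 2 * k + 1 := p.2
      simp only [evenBlock, Function.comp_def, if_neg hp]
      congr 1
      split_ifs <;> omega

/-- The traces of the odd columns on the even rows are conditionally i.i.d. given the even block,
and each is conditionally independent of all the other columns. -/
theorem SeparatelyExchangeable.exists_colKernel (hX : ∀ i j, Measurable (X i j))
    (h : SeparatelyExchangeable μ X) :
    ∃ γ : Kernel (ℕ × ℕ → 𝕏) (ℕ → 𝕏), IsMarkovKernel γ ∧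
      ∀ (k : ℕ) (s : Set (ℕ → 𝕏)) (Z : Ω → ℝ≥0∞), MeasurableSet s →
        Measurable[entrySigma X {p | p.2 ≠ 2 * k + 1}] Z →
        ∫⁻ ω, s.indicator 1 (colTrace X (2 * k + 1) ω) * Z ω ∂μ
          = ∫⁻ ω, γ (evenBlock X ω) s * Z ω ∂μ := by
  obtain ⟨β, hβ, hβ'⟩ := (h.transpose hX).exists_rowKernel (fun i j => hX j i)
  have hsw : Measurable fun (x : ℕ × ℕ → 𝕏) (p : ℕ × ℕ) => x p.swap :=
    measurable_pi_lambda _ fun p => measurable_pi_apply p.swap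
  exact ⟨β.comap _ hsw, inferInstance, fun k s Z hs hZ =>
    hβ' k s Z hs (hZ.mono (entrySigma_transpose _) le_rfl)⟩

/-- An entry with odd indices is conditionally independent of all the other entries given the even
block and the traces of its row and column. -/
theorem SeparatelyExchangeable.exists_entryKernel (hX : ∀ i j, Measurable (X i j))
    (h : SeparatelyExchangeable μ X) :
    ∃ κ : Kernel ((ℕ × ℕ → 𝕏) × (ℕ → 𝕏) × (ℕ → 𝕏)) 𝕏, IsMarkovKernel κ ∧
      ∀ (k l : ℕ) (s : Set 𝕏) (Z : Ω → ℝ≥0∞), MeasurableSet s →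
        Measurable[entrySigma X {p | p ≠ (2 * k + 1, 2 * l + 1)}] Z →
        ∫⁻ ω, s.indicator 1 (X (2 * k + 1) (2 * l + 1) ω) * Z ω ∂μ
          = ∫⁻ ω, κ (evenBlock X ω, rowTrace X (2 * k + 1) ω, colTrace X (2 * l + 1) ω) s
              * Z ω ∂μ := by
  refine ⟨condDistrib (X 1 1) (fun ω => (evenBlock X ω, rowTrace X 1 ω, colTrace X 1 ω)) μ,
    inferInstance, fun k l s Z hs hZ => ?_⟩
  have hdist : condDistrib (X (2 * k + 1) (2 * l + 1))
        (fun ω => (evenBlock X ω, rowTrace X (2 * k + 1) ω, colTrace X (2 * l + 1) ω)) μ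
      = condDistrib (X 1 1) (fun ω => (evenBlock X ω, rowTrace X 1 ω, colTrace X 1 ω)) μ := by
    refine condDistrib_eq_of_identDistrib ?_
    have hid := h.identDistrib_injective (μ := μ) hX
      (σ := fun i => if i % 2 = 0 then i else i + 2 * k)
      (τ := fun i => if i % 2 = 0 then i else i + 2 * l)
      (fun a b hab => by dsimp only at hab; split_ifs at hab <;> omega)
      (fun a b hab => by dsimp only at hab; split_ifs at hab <;> omega)
    have := hid.comp (u := fun x : ℕ × ℕ → 𝕏 =>
      (((fun p : ℕ × ℕ => x (2 * p.1, 2 * p.2)), (fun j : ℕ => x (1, 2 * j)),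
        fun i : ℕ => x (2 * i, 1)), x (1, 1))) (by fun_prop)
    convert this using 1
    swap
    · rfl
    ext ω : 1
    simp [funext_iff, evenBlock, rowTrace, colTrace, add_comm]
  rw [← hdist]
  refine lintegral_indicator_mul_eq_condDistrib
    (G := fun ω (p : {p : ℕ × ℕ | p ≠ (2 * k + 1, 2 * l + 1)}) => X p.1.1 p.1.2 ω)
    ((measurable_evenBlock fun _ _ => hX _ _).prodMk ((measurable_rowTrace fun _ => hX _ _).prodMk
      (measurable_colTrace fun _ => hX _ _)))
    (measurable_pi_lambda _ fun p => hX _ _) (hX _ _) ?_ (C := {s | MeasurableSet s})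
    MeasurableSpace.isPiSystem_measurableSet MeasurableSpace.generateFrom_measurableSet.symm
    (fun c hc => ?_) hs hZ
  · refine Measurable.comap_le (m₁ := entrySigma X {p | p ≠ (2 * k + 1, 2 * l + 1)})
      ((measurable_evenBlock fun i j => measurable_entrySigma ?_).prodMk
        ((measurable_rowTrace fun j => measurable_entrySigma ?_).prodMk
          (measurable_colTrace fun i => measurable_entrySigma ?_))) <;>
    · simp only [Set.mem_ofPred_eq, ne_eq, Prod.mk.injEq]
      omega
  · refine ⟨fun a p => if p.1.1 = 2 * k + 1 then a.2.1 p.1.2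
      else if p.1.2 = 2 * l + 1 then a.2.2 p.1.1 else a.1 p.1, ?_, ?_⟩
    · refine measurable_pi_lambda _ fun p => ?_
      split_ifs <;> fun_prop
    have hid := h.identDistrib_injective (μ := μ) hX
      (σ := fun i => if i = 2 * k + 1 then i else 2 * i)
      (τ := fun j => if j = 2 * l + 1 then j else 2 * j)
      (fun a b hab => by dsimp only at hab; split_ifs at hab <;> omega)
      (fun a b hab => by dsimp only at hab; split_ifs at hab <;> omega)
    have := hid.comp (u := fun x : ℕ × ℕ → 𝕏 =>
      (c.indicator (1 : 𝕏 → ℝ) (x (2 * k + 1, 2 * l + 1)),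
        fun p : {p : ℕ × ℕ | p ≠ (2 * k + 1, 2 * l + 1)} => x p.1))
      (((measurable_one.indicator hc).comp (by fun_prop)).prodMk (by fun_prop))
    convert this using 1
    swap
    · rfl
    ext ω : 1
    refine Prod.ext ?_ ?_
    · simp
    · refine funext fun ⟨⟨i, j⟩, hp⟩ => ?_
      simp only [Set.mem_ofPred_eq, ne_eq, Prod.mk.injEq, not_and] at hp
      simp only [evenBlock, rowTrace, colTrace, Function.comp_def]
      split_ifs with h1 h2 h2
      · exact absurd h2 (hp h1)
      · rw [h1]
      · rw [h2]
      · rfl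

end Conditioning

/-- Replacing successively each factor `a i` by `b i`, when this can be done inside an integral
against any function measurable for a σ-algebra that the other factors are measurable for. -/
theorem lintegral_prod_mul_eq_of_forall_replace {Ω ι : Type*} [DecidableEq ι]
    {mΩ : MeasurableSpace Ω} {μ : Measure Ω} {m : ι → MeasurableSpace Ω} {a b : ι → Ω → ℝ≥0∞}
    (ha : ∀ i j, j ≠ i → Measurable[m i] (a j)) (hb : ∀ i j, Measurable[m i] (b j))
    (h : ∀ i (Z : Ω → ℝ≥0∞), Measurable[m i] Z →
      ∫⁻ ω, a i ω * Z ω ∂μ = ∫⁻ ω, b i ω * Z ω ∂μ)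
    (S : Finset ι) (W : Ω → ℝ≥0∞) (hW : ∀ i, Measurable[m i] W) :
    ∫⁻ ω, (∏ i ∈ S, a i ω) * W ω ∂μ = ∫⁻ ω, (∏ i ∈ S, b i ω) * W ω ∂μ := by
  induction S using Finset.induction_on generalizing W with
  | empty => rfl
  | insert i S hi ih =>
    simp only [Finset.prod_insert hi, mul_assoc]
    rw [h i (fun ω => (∏ j ∈ S, a j ω) * W ω)]
    · simp only [mul_left_comm (b i _)]
      exact ih (fun ω => b i ω * W ω) fun j => (hb j i).mul (hW j)
    · exact (Finset.measurable_fun_prod S fun j hj =>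
        ha i j (ne_of_mem_of_not_mem hj hi)).mul (hW i)

theorem ext_of_forall_pi_univ {ι : Type*} [Finite ι] {α : ι → Type*} [∀ i, MeasurableSpace (α i)]
    {μ ν : Measure (∀ i, α i)} [IsProbabilityMeasure μ] [IsProbabilityMeasure ν]
    (h : ∀ s : ∀ i, Set (α i), (∀ i, MeasurableSet (s i)) →
      μ (Set.univ.pi s) = ν (Set.univ.pi s)) : μ = ν := by
  refine ext_of_generate_finite _ generateFrom_pi.symm isPiSystem_pi ?_ (by simp)
  rintro _ ⟨s, hs, rfl⟩
  exact h s fun i => hs i trivial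

theorem ext_of_forall_prod_pi_univ {ι ι' α β γ : Type*} [Finite ι] [Finite ι']
    [MeasurableSpace α] [MeasurableSpace β] [MeasurableSpace γ]
    {μ ν : Measure (α × (ι → β) × (ι' → γ))} [IsProbabilityMeasure μ] [IsProbabilityMeasure ν]
    (h : ∀ (s : Set α) (t : ι → Set β) (u : ι' → Set γ), MeasurableSet s →
      (∀ i, MeasurableSet (t i)) → (∀ j, MeasurableSet (u j)) →
      μ (s ×ˢ Set.univ.pi t ×ˢ Set.univ.pi u) = ν (s ×ˢ Set.univ.pi t ×ˢ Set.univ.pi u)) :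
    μ = ν := by
  have hβ := IsCountablySpanning.pi fun _ : ι => isCountablySpanning_measurableSet (α := β)
  have hγ := IsCountablySpanning.pi fun _ : ι' => isCountablySpanning_measurableSet (α := γ)
  have hgen := generateFrom_eq_prod (MeasurableSpace.generateFrom_measurableSet (α := α))
    (generateFrom_eq_prod (generateFrom_pi (ι := ι) (α := fun _ => β))
      (generateFrom_pi (ι := ι') (α := fun _ => γ)) hβ hγ)
    isCountablySpanning_measurableSet (hβ.prod hγ)
  refine ext_of_generate_finite _ hgen.symm
    (MeasurableSpace.isPiSystem_measurableSet.prod (isPiSystem_pi.prod isPiSystem_pi)) ?_ (by simp)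
  rintro _ ⟨s, hs, _, ⟨_, ⟨t, ht, rfl⟩, _, ⟨u, hu, rfl⟩, rfl⟩, rfl⟩
  exact h s t u hs (fun i => ht i trivial) fun j => hu j trivial

/-- Every Markov kernel to a standard Borel space is realized by a uniform random variable. -/
theorem Kernel.exists_measurable_map_unif_eq {α β : Type*} [MeasurableSpace α] [MeasurableSpace β]
    [StandardBorelSpace β] [Nonempty β] (κ : Kernel α β) [IsMarkovKernel κ] :
    ∃ f : α → ℝ → β, Measurable (Function.uncurry f) ∧ ∀ a, unif.map (f a) = κ a := by
  obtain ⟨f, hf, hfκ⟩ := κ.exists_measurable_map_eq_unitInterval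
  have hp : Measurable (Set.projIcc (0 : ℝ) 1 zero_le_one) := continuous_projIcc.measurable
  have hunif : unif.map (Set.projIcc (0 : ℝ) 1 zero_le_one) = volume := by
    have : unif = (volume : Measure unitInterval).map Subtype.val :=
      (map_comap_subtype_coe measurableSet_Icc volume).symm
    rw [this, Measure.map_map hp measurable_subtype_coe]
    convert Measure.map_id
    ext x : 1
    exact Set.projIcc_val _ x
  refine ⟨fun a x => f a (Set.projIcc 0 1 zero_le_one x), ?_, fun a => ?_⟩
  · exact hf.comp (measurable_fst.prodMk (hp.comp measurable_snd))
  · have hfa : Measurable (f a) := hf.comp measurable_prodMk_left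
    rw [← hfκ, ← hunif, Measure.map_map hfa hp]
    rfl

theorem indicator_pi_univ_one_eq_prod {ι : Type*} [Fintype ι] {α : ι → Type*}
    (s : ∀ i, Set (α i)) (x : ∀ i, α i) :
    (Set.univ.pi s).indicator (1 : (∀ i, α i) → ℝ≥0∞) x
      = ∏ i, (s i).indicator (1 : α i → ℝ≥0∞) (x i) := by
  classical
  simp only [Set.indicator_apply, Pi.one_apply, Set.mem_univ_pi]
  by_cases h : ∀ i, x i ∈ s i
  · simp [h]
  · obtain ⟨i, hi⟩ := not_forall.1 h
    rw [if_neg h, Finset.prod_eq_zero (Finset.mem_univ i) (if_neg hi)]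

theorem pi_preimage_eq_prod_map {ι α : Type*} [Fintype ι] [MeasurableSpace α] {ρ : Measure ℝ}
    [SigmaFinite ρ] {f : ι → ℝ → α} (hf : ∀ i, Measurable (f i)) {s : ι → Set α}
    (hs : ∀ i, MeasurableSet (s i)) :
    Measure.pi (fun _ : ι => ρ) (Set.univ.pi fun i => f i ⁻¹' s i)
      = ∏ i, ρ.map (f i) (s i) := by
  rw [Measure.pi_pi]
  exact Finset.prod_congr rfl fun i _ => (Measure.map_apply (hf i) (hs i)).symm

/-- If `B` and `C` are families which, given `A`, are jointly conditionally independent with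
conditional laws `β` and `γ`, then `(A, B, C)` can be coded by independent uniform variables. -/
theorem map_eq_map_unif_of_lintegral_eq {Ω ι ι' 𝔸 𝔹 ℭ : Type*} [Fintype ι] [Fintype ι']
    [MeasurableSpace Ω] [MeasurableSpace 𝔸] [MeasurableSpace 𝔹] [MeasurableSpace ℭ]
    {μ : Measure Ω} [IsProbabilityMeasure μ] {A : Ω → 𝔸} {B : ι → Ω → 𝔹} {C : ι' → Ω → ℭ}
    (hA : Measurable A) (hB : ∀ i, Measurable (B i)) (hC : ∀ j, Measurable (C j))
    {β : Kernel 𝔸 𝔹} {γ : Kernel 𝔸 ℭ}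
    (h : ∀ (s : Set 𝔸) (t : ι → Set 𝔹) (u : ι' → Set ℭ), MeasurableSet s →
      (∀ i, MeasurableSet (t i)) → (∀ j, MeasurableSet (u j)) →
      ∫⁻ ω, (∏ i, (t i).indicator 1 (B i ω)) *
          ((∏ j, (u j).indicator 1 (C j ω)) * s.indicator 1 (A ω)) ∂μ
        = ∫⁻ ω, (∏ i, β (A ω) (t i)) * ((∏ j, γ (A ω) (u j)) * s.indicator 1 (A ω)) ∂μ)
    {a : ℝ → 𝔸} {b : 𝔸 → ℝ → 𝔹} {c : 𝔸 → ℝ → ℭ} (ha : Measurable a)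
    (hb : Measurable (Function.uncurry b)) (hc : Measurable (Function.uncurry c))
    (haA : unif.map a = μ.map A) (hbβ : ∀ x, unif.map (b x) = β x)
    (hcγ : ∀ x, unif.map (c x) = γ x) :
    μ.map (fun ω => (A ω, (fun i => B i ω), fun j => C j ω))
      = (unif.prod ((Measure.pi fun _ : ι => unif).prod (Measure.pi fun _ : ι' => unif))).map
        fun w => (a w.1, (fun i => b (a w.1) (w.2.1 i)), fun j => c (a w.1) (w.2.2 j)) := by
  have hF : Measurable fun ω => (A ω, (fun i => B i ω), fun j => C j ω) := by fun_prop
  have hG : Measurable fun w : ℝ × (ι → ℝ) × (ι' → ℝ) =>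
      (a w.1, (fun i => b (a w.1) (w.2.1 i)), fun j => c (a w.1) (w.2.2 j)) := by
    refine (ha.comp measurable_fst).prodMk (.prodMk ?_ ?_)
    · exact measurable_pi_lambda _ fun i => hb.comp ((ha.comp measurable_fst).prodMk (by fun_prop))
    · exact measurable_pi_lambda _ fun i => hc.comp ((ha.comp measurable_fst).prodMk (by fun_prop))
  have := Measure.isProbabilityMeasure_map (μ := μ) hF.aemeasurable
  have := Measure.isProbabilityMeasure_map (μ := unif.prod ((Measure.pi fun _ : ι => unif).prod
    (Measure.pi fun _ : ι' => unif))) hG.aemeasurable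
  refine ext_of_forall_prod_pi_univ fun s t u hs ht hu => ?_
  have hm : MeasurableSet (s ×ˢ Set.univ.pi t ×ˢ Set.univ.pi u) :=
    hs.prod ((MeasurableSet.univ_pi ht).prod (MeasurableSet.univ_pi hu))
  have hbx (x) : Measurable (b x) := hb.comp measurable_prodMk_left
  have hcx (x) : Measurable (c x) := hc.comp measurable_prodMk_left
  have hmeas : Measurable fun x => (∏ i, β x (t i)) * ((∏ j, γ x (u j)) * s.indicator 1 x) := by
    refine (Finset.measurable_fun_prod _ fun i _ => β.measurable_coe (ht i)).mul
      ((Finset.measurable_fun_prod _ fun i _ => γ.measurable_coe (hu i)).mul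
        (measurable_one.indicator hs))
  calc μ.map (fun ω => (A ω, (fun i => B i ω), fun j => C j ω)) (s ×ˢ Set.univ.pi t ×ˢ Set.univ.pi u)
      = ∫⁻ ω, (∏ i, (t i).indicator 1 (B i ω)) *
          ((∏ j, (u j).indicator 1 (C j ω)) * s.indicator 1 (A ω)) ∂μ := by
        rw [← lintegral_indicator_one hm, lintegral_map (measurable_one.indicator hm) hF]
        refine lintegral_congr fun ω => ?_
        rw [← indicator_pi_univ_one_eq_prod t (fun i => B i ω),
          ← indicator_pi_univ_one_eq_prod u (fun i => C i ω)]
        classical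
        simp only [Set.indicator_apply, Set.mem_prod, Pi.one_apply, ite_and]
        split_ifs <;> simp
    _ = ∫⁻ x, (∏ i, β x (t i)) * ((∏ j, γ x (u j)) * s.indicator 1 x) ∂(unif.map a) := by
        rw [h s t u hs ht hu, haA, lintegral_map hmeas hA]
    _ = _ := by
        rw [lintegral_map hmeas ha, Measure.map_apply hG hm, Measure.prod_apply (hG hm)]
        refine lintegral_congr fun x => ?_
        by_cases hx : a x ∈ s
        · have : Prod.mk x ⁻¹' ((fun w : ℝ × (ι → ℝ) × (ι' → ℝ) =>
              (a w.1, (fun i => b (a w.1) (w.2.1 i)), fun j => c (a w.1) (w.2.2 j))) ⁻¹'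
                (s ×ˢ Set.univ.pi t ×ˢ Set.univ.pi u))
              = (Set.univ.pi fun i => b (a x) ⁻¹' t i) ×ˢ
                (Set.univ.pi fun j => c (a x) ⁻¹' u j) := by
            ext w
            simp [hx]
          rw [this, Measure.prod_prod, pi_preimage_eq_prod_map (fun _ => hbx _) ht,
            pi_preimage_eq_prod_map (fun _ => hcx _) hu]
          simp [hbβ, hcγ, hx]
        · have : Prod.mk x ⁻¹' ((fun w : ℝ × (ι → ℝ) × (ι' → ℝ) =>
              (a w.1, (fun i => b (a w.1) (w.2.1 i)), fun j => c (a w.1) (w.2.2 j))) ⁻¹'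
                (s ×ˢ Set.univ.pi t ×ˢ Set.univ.pi u)) = ∅ := by
            ext w
            simp [hx]
          simp [this, hx]

theorem measurePreserving_pi_comp_equiv {ι ι' α : Type*} [Fintype ι] [Fintype ι']
    [MeasurableSpace α] (ρ : Measure α) [SigmaFinite ρ] (e : ι' ≃ ι) :
    MeasurePreserving (fun v : ι → α => v ∘ e) (Measure.pi fun _ => ρ) (Measure.pi fun _ => ρ) := by
  convert measurePreserving_piCongrLeft (fun _ : ι' => ρ) e.symm using 1
  ext v i
  simp [MeasurableEquiv.coe_piCongrLeft, Equiv.piCongrLeft_apply]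

/-- The law of the uniform variables coding an `n × n` array. -/
noncomputable abbrev codingMeasure (n : ℕ) :
    Measure (ℝ × (Fin n → ℝ) × (Fin n → ℝ) × (Fin n × Fin n → ℝ)) :=
  unif.prod ((Measure.pi fun _ : Fin n => unif).prod
    ((Measure.pi fun _ : Fin n => unif).prod (Measure.pi fun _ : Fin n × Fin n => unif)))

theorem measurable_coding {𝕏 : Type*} [MeasurableSpace 𝕏] {H : ℝ → ℝ → ℝ → ℝ → 𝕏}
    (hH : Measurable fun q : ℝ × ℝ × ℝ × ℝ => H q.1 q.2.1 q.2.2.1 q.2.2.2) (n : ℕ) :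
    Measurable fun (w : ℝ × (Fin n → ℝ) × (Fin n → ℝ) × (Fin n × Fin n → ℝ)) (p : Fin n × Fin n) =>
      H w.1 (w.2.1 p.1) (w.2.2.1 p.2) (w.2.2.2 p) :=
  measurable_pi_lambda _ fun p => hH.comp (f := fun w : ℝ × (Fin n → ℝ) × (Fin n → ℝ) ×
    (Fin n × Fin n → ℝ) => (w.1, w.2.1 p.1, w.2.2.1 p.2, w.2.2.2 p)) (by fun_prop)

theorem exists_perm_fin_of_forall_le {σ : Equiv.Perm ℕ} {n : ℕ} (h : ∀ i, n ≤ i → σ i = i) :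
    ∃ σ' : Equiv.Perm (Fin n), ∀ i : Fin n, (σ' i : ℕ) = σ i := by
  have hlt (i : Fin n) : σ i < n := by
    by_contra! hi
    have := σ.injective (h _ hi)
    omega
  refine ⟨Equiv.ofBijective (fun i => ⟨σ i, hlt i⟩) (Finite.injective_iff_bijective.1 ?_),
    fun i => rfl⟩
  intro i j hij
  exact Fin.ext (σ.injective (congrArg Fin.val hij))

theorem separatelyExchangeable_of_coding {Ω 𝕏 : Type*} [MeasurableSpace Ω] [MeasurableSpace 𝕏]
    {μ : Measure Ω} [IsProbabilityMeasure μ] {X : ℕ → ℕ → Ω → 𝕏} (hX : ∀ i j, Measurable (X i j))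
    {H : ℝ → ℝ → ℝ → ℝ → 𝕏}
    (hH : Measurable fun q : ℝ × ℝ × ℝ × ℝ => H q.1 q.2.1 q.2.2.1 q.2.2.2)
    (h : ∀ n, μ.map (fun ω (p : Fin n × Fin n) => X p.1 p.2 ω)
      = (codingMeasure n).map fun w p => H w.1 (w.2.1 p.1) (w.2.2.1 p.2) (w.2.2.2 p)) :
    SeparatelyExchangeable μ X := by
  intro σ τ hσ hτ
  refine Measure.map_pi_eq_of_forall_finset (measurable_pi_lambda _ fun p => hX _ _)
    (measurable_pi_lambda _ fun p => hX _ _) fun I => ?_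
  obtain ⟨n₁, hn₁⟩ := hσ.bddAbove
  obtain ⟨n₂, hn₂⟩ := hτ.bddAbove
  set n := max (max n₁ n₂) (max (I.sup Prod.fst) (I.sup Prod.snd)) + 1 with hn
  have hI (p) (hp : p ∈ I) : p.1 < n ∧ p.2 < n := by
    have := Finset.le_sup (f := Prod.fst) hp
    have := Finset.le_sup (f := Prod.snd) hp
    omega
  obtain ⟨σ', hσ'⟩ := exists_perm_fin_of_forall_le (σ := σ) (n := n) fun i hi => by
    by_contra hne
    have := hn₁ hne
    omega
  obtain ⟨τ', hτ'⟩ := exists_perm_fin_of_forall_le (σ := τ) (n := n) fun i hi => by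
    by_contra hne
    have := hn₂ hne
    omega
  have hXn : Measurable fun ω (p : Fin n × Fin n) => X p.1 p.2 ω :=
    measurable_pi_lambda _ fun p => hX _ _
  have hT : MeasurePreserving
      (Prod.map id (Prod.map (· ∘ σ') (Prod.map (· ∘ τ') (· ∘ σ'.prodCongr τ'))))
      (codingMeasure n) (codingMeasure n) :=
    (MeasurePreserving.id _).prod ((measurePreserving_pi_comp_equiv _ _).prod
      ((measurePreserving_pi_comp_equiv _ _).prod (measurePreserving_pi_comp_equiv _ _)))
  have hperm : μ.map (fun ω (p : Fin n × Fin n) => X (σ p.1) (τ p.2) ω)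
      = μ.map (fun ω (p : Fin n × Fin n) => X p.1 p.2 ω) := by
    have hcomp : Measurable fun (x : Fin n × Fin n → 𝕏) (p : Fin n × Fin n) =>
      x (σ' p.1, τ' p.2) := by fun_prop
    have := congrArg (Measure.map fun (x : Fin n × Fin n → 𝕏) (p : Fin n × Fin n) =>
      x (σ' p.1, τ' p.2)) (h n)
    rw [Measure.map_map hcomp hXn, Measure.map_map hcomp (measurable_coding hH n)] at this
    rw [h n, ← hT.map_eq, Measure.map_map (measurable_coding hH n) hT.measurable]
    convert this using 1
    · simp only [Function.comp_def, hσ', hτ']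
    · rfl
  have hres : Measurable fun (x : Fin n × Fin n → 𝕏) (p : I) =>
      x (⟨p.1.1, (hI p.1 p.2).1⟩, ⟨p.1.2, (hI p.1 p.2).2⟩) := by fun_prop
  have := congrArg (Measure.map fun (x : Fin n × Fin n → 𝕏) (p : I) =>
      x (⟨p.1.1, (hI p.1 p.2).1⟩, ⟨p.1.2, (hI p.1 p.2).2⟩)) hperm
  rwa [Measure.map_map hres (measurable_pi_lambda _ fun p => hX _ _),
    Measure.map_map hres hXn] at this

section Coding

variable {Ω 𝕏 : Type*} [MeasurableSpace Ω] [MeasurableSpace 𝕏] [StandardBorelSpace 𝕏] [Nonempty 𝕏]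
  {μ : Measure Ω} [IsProbabilityMeasure μ] {X : ℕ → ℕ → Ω → 𝕏}

/-- The even block together with the traces of the odd rows and columns is coded by independent
uniform variables. -/
theorem SeparatelyExchangeable.exists_traces_coding (hX : ∀ i j, Measurable (X i j))
    (h : SeparatelyExchangeable μ X) :
    ∃ (a : ℝ → ℕ × ℕ → 𝕏) (b c : (ℕ × ℕ → 𝕏) → ℝ → ℕ → 𝕏), Measurable a ∧
      Measurable (Function.uncurry b) ∧ Measurable (Function.uncurry c) ∧
      ∀ n : ℕ, μ.map (fun ω => (evenBlock X ω, (fun i : Fin n => rowTrace X (2 * i + 1) ω),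
          fun j : Fin n => colTrace X (2 * j + 1) ω))
        = (unif.prod ((Measure.pi fun _ : Fin n => unif).prod
            (Measure.pi fun _ : Fin n => unif))).map
          fun w => (a w.1, (fun i => b (a w.1) (w.2.1 i)), fun j => c (a w.1) (w.2.2 j)) := by
  have hA : Measurable (evenBlock X) := measurable_evenBlock fun _ _ => hX _ _
  have := Measure.isProbabilityMeasure_map (μ := μ) hA.aemeasurable
  obtain ⟨β, hβ, hrow⟩ := h.exists_rowKernel hX
  obtain ⟨γ, hγ, hcol⟩ := h.exists_colKernel hX
  obtain ⟨a, ha, haA⟩ :=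
    Kernel.exists_measurable_map_unif_eq (Kernel.const Unit (μ.map (evenBlock X)))
  obtain ⟨b, hb, hbβ⟩ := Kernel.exists_measurable_map_unif_eq β
  obtain ⟨c, hc, hcγ⟩ := Kernel.exists_measurable_map_unif_eq γ
  refine ⟨a (), b, c, ha.comp measurable_prodMk_left, hb, hc, fun n => ?_⟩
  refine map_eq_map_unif_of_lintegral_eq hA (fun _ => measurable_rowTrace fun _ => hX _ _)
    (fun _ => measurable_colTrace fun _ => hX _ _) (β := β) (γ := γ) (fun s t u hs ht hu => ?_)
    (ha.comp measurable_prodMk_left) hb hc (by simpa using haA ()) hbβ hcγ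
  have hArow (i : ℕ) : Measurable[entrySigma X {p | p.1 ≠ 2 * i + 1}] (evenBlock X) :=
    measurable_evenBlock fun k l => measurable_entrySigma (by simp; omega)
  have hAcol (i : ℕ) : Measurable[entrySigma X {p | p.2 ≠ 2 * i + 1}] (evenBlock X) :=
    measurable_evenBlock fun k l => measurable_entrySigma (by simp; omega)
  rw [lintegral_prod_mul_eq_of_forall_replace (m := fun i : Fin n =>
      entrySigma X {p | p.1 ≠ 2 * (i : ℕ) + 1}) (a := fun i ω => (t i).indicator 1 _)
      (b := fun i ω => β (evenBlock X ω) (t i))]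
  · simp only [mul_left_comm (∏ i, β _ (t i))]
    rw [lintegral_prod_mul_eq_of_forall_replace (m := fun i : Fin n =>
      entrySigma X {p | p.2 ≠ 2 * (i : ℕ) + 1}) (a := fun i ω => (u i).indicator 1 _)
      (b := fun i ω => γ (evenBlock X ω) (u i))]
    · refine fun i j hij => (measurable_one.indicator (hu j)).comp
        (measurable_colTrace fun k => measurable_entrySigma ?_)
      simp only [Set.mem_ofPred_eq]
      omega
    · exact fun i j => (γ.measurable_coe (hu j)).comp (hAcol i)
    · exact fun i Z hZ => hcol i _ Z (hu i) hZ
    · refine fun i => (Finset.measurable_fun_prod _ fun j _ =>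
        (β.measurable_coe (ht j)).comp (hAcol i)).mul ((measurable_one.indicator hs).comp (hAcol i))
  · refine fun i j hij => (measurable_one.indicator (ht j)).comp
        (measurable_rowTrace fun k => measurable_entrySigma ?_)
    simp only [Set.mem_ofPred_eq]
    omega
  · exact fun i j => (β.measurable_coe (ht j)).comp (hArow i)
  · exact fun i Z hZ => hrow i _ Z (ht i) hZ
  · refine fun i => (Finset.measurable_fun_prod _ fun j _ =>
        (measurable_one.indicator (hu j)).comp (measurable_colTrace fun k =>
          measurable_entrySigma ?_)).mul ((measurable_one.indicator hs).comp (hArow i))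
    simp only [Set.mem_ofPred_eq]
    omega

theorem SeparatelyExchangeable.exists_coding (hX : ∀ i j, Measurable (X i j))
    (h : SeparatelyExchangeable μ X) :
    ∃ H : ℝ → ℝ → ℝ → ℝ → 𝕏,
      Measurable (fun q : ℝ × ℝ × ℝ × ℝ => H q.1 q.2.1 q.2.2.1 q.2.2.2) ∧
      ∀ n : ℕ, μ.map (fun ω (p : Fin n × Fin n) => X p.1 p.2 ω)
        = (codingMeasure n).map fun w p => H w.1 (w.2.1 p.1) (w.2.2.1 p.2) (w.2.2.2 p) := by
  obtain ⟨a, b, c, ha, hb, hc, hlaw⟩ := h.exists_traces_coding hX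
  obtain ⟨κ, hκ, hentry⟩ := h.exists_entryKernel hX
  obtain ⟨f, hf, hfκ⟩ := Kernel.exists_measurable_map_unif_eq κ
  have hfx (x) : Measurable (f x) := hf.comp measurable_prodMk_left
  have hH : Measurable fun q : ℝ × ℝ × ℝ × ℝ =>
      f (a q.1, b (a q.1) q.2.1, c (a q.1) q.2.2.1) q.2.2.2 := by
    have ha' : Measurable fun q : ℝ × ℝ × ℝ × ℝ => a q.1 := ha.comp measurable_fst
    refine hf.comp (.prodMk (ha'.prodMk (.prodMk ?_ ?_)) (by fun_prop))
    · exact hb.comp (ha'.prodMk (by fun_prop))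
    · exact hc.comp (ha'.prodMk (by fun_prop))
  refine ⟨fun u v w z => f (a u, b (a u) v, c (a u) w) z, hH, fun n => ?_⟩
  have hcode := measurable_coding (H := fun u v w z => f (a u, b (a u) v, c (a u) w) z) hH n
  have hXn : Measurable fun ω (p : Fin n × Fin n) => X p.1 p.2 ω :=
    measurable_pi_lambda _ fun p => hX _ _
  have hXodd : Measurable fun ω (p : Fin n × Fin n) => X (2 * p.1 + 1) (2 * p.2 + 1) ω :=
    measurable_pi_lambda _ fun p => hX _ _
  have hodd : μ.map (fun ω (p : Fin n × Fin n) => X p.1 p.2 ω)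
      = μ.map fun ω (p : Fin n × Fin n) => X (2 * p.1 + 1) (2 * p.2 + 1) ω := by
    have hid := h.identDistrib_injective (μ := μ) hX (σ := fun i => 2 * i + 1)
      (τ := fun i => 2 * i + 1) (fun _ _ hab => by dsimp only at hab; omega)
      (fun _ _ hab => by dsimp only at hab; omega)
    exact (hid.comp (u := fun (x : ℕ × ℕ → 𝕏) (p : Fin n × Fin n) => x (p.1, p.2))
      (by fun_prop)).map_eq.symm
  have := Measure.isProbabilityMeasure_map (μ := μ) hXn.aemeasurable
  have := Measure.isProbabilityMeasure_map (μ := codingMeasure n) hcode.aemeasurable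
  refine ext_of_forall_pi_univ fun s hs => ?_
  have hm : MeasurableSet (Set.univ.pi s) := .univ_pi hs
  have hABC : Measurable fun ω => (evenBlock X ω, (fun i : Fin n => rowTrace X (2 * i + 1) ω),
      fun j : Fin n => colTrace X (2 * j + 1) ω) :=
    (measurable_evenBlock fun _ _ => hX _ _).prodMk
      ((measurable_pi_lambda _ fun _ => measurable_rowTrace fun _ => hX _ _).prodMk
        (measurable_pi_lambda _ fun _ => measurable_colTrace fun _ => hX _ _))
  have hcodeABC : Measurable fun w : ℝ × (Fin n → ℝ) × (Fin n → ℝ) =>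
      (a w.1, (fun i => b (a w.1) (w.2.1 i)), fun j => c (a w.1) (w.2.2 j)) := by
    refine (ha.comp measurable_fst).prodMk (.prodMk ?_ ?_)
    · exact measurable_pi_lambda _ fun i => hb.comp ((ha.comp measurable_fst).prodMk (by fun_prop))
    · exact measurable_pi_lambda _ fun i => hc.comp ((ha.comp measurable_fst).prodMk (by fun_prop))
  have hκm : Measurable fun y : (ℕ × ℕ → 𝕏) × (Fin n → ℕ → 𝕏) × (Fin n → ℕ → 𝕏) =>
      ∏ p : Fin n × Fin n, κ (y.1, y.2.1 p.1, y.2.2 p.2) (s p) :=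
    Finset.measurable_fun_prod _ fun p _ => (κ.measurable_coe (hs p)).comp (by fun_prop)
  calc μ.map (fun ω (p : Fin n × Fin n) => X p.1 p.2 ω) (Set.univ.pi s)
      = ∫⁻ ω, (∏ p : Fin n × Fin n, (s p).indicator 1 (X (2 * p.1 + 1) (2 * p.2 + 1) ω)) * 1 ∂μ := by
        rw [hodd, ← lintegral_indicator_one hm, lintegral_map (measurable_one.indicator hm) hXodd]
        simp only [indicator_pi_univ_one_eq_prod, mul_one]
    _ = ∫⁻ ω, (∏ p : Fin n × Fin n, κ (evenBlock X ω, rowTrace X (2 * p.1 + 1) ω,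
          colTrace X (2 * p.2 + 1) ω) (s p)) * 1 ∂μ := by
        refine lintegral_prod_mul_eq_of_forall_replace (m := fun p : Fin n × Fin n =>
          entrySigma X {q | q ≠ (2 * (p.1 : ℕ) + 1, 2 * (p.2 : ℕ) + 1)})
          (a := fun p ω => (s p).indicator 1 (X (2 * p.1 + 1) (2 * p.2 + 1) ω))
          (b := fun p ω => κ (evenBlock X ω, rowTrace X (2 * p.1 + 1) ω,
            colTrace X (2 * p.2 + 1) ω) (s p)) ?_ ?_ ?_ _ _ fun _ => measurable_const
        · refine fun p q hpq => (measurable_one.indicator (hs q)).comp (measurable_entrySigma ?_)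
          simp only [Set.mem_ofPred_eq, ne_eq, Prod.ext_iff, Fin.ext_iff] at hpq ⊢
          omega
        · refine fun p q => (κ.measurable_coe (hs q)).comp
            ((measurable_evenBlock fun i j => measurable_entrySigma ?_).prodMk
              ((measurable_rowTrace fun j => measurable_entrySigma ?_).prodMk
                (measurable_colTrace fun i => measurable_entrySigma ?_))) <;>
          · simp only [Set.mem_ofPred_eq, ne_eq, Prod.mk.injEq]
            omega
        · exact fun p Z hZ => hentry p.1 p.2 _ Z (hs p) hZ
    _ = ∫⁻ w : ℝ × (Fin n → ℝ) × (Fin n → ℝ), ∏ p : Fin n × Fin n,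
          κ (a w.1, b (a w.1) (w.2.1 p.1), c (a w.1) (w.2.2 p.2)) (s p)
          ∂(unif.prod ((Measure.pi fun _ : Fin n => unif).prod
            (Measure.pi fun _ : Fin n => unif))) := by
        have := lintegral_map (μ := μ) hκm hABC
        rw [hlaw n, lintegral_map hκm hcodeABC] at this
        simpa only [mul_one] using this.symm
    _ = _ := by
        have hprod : Measurable fun w : ℝ × (Fin n → ℝ) × (Fin n → ℝ) => ∏ p : Fin n × Fin n,
            κ (a w.1, b (a w.1) (w.2.1 p.1), c (a w.1) (w.2.2 p.2)) (s p) := hκm.comp hcodeABC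
        have hmm := hcode hm
        rw [Measure.map_apply hcode hm, Measure.prod_apply hmm,
          lintegral_prod _ hprod.aemeasurable]
        refine lintegral_congr fun x => ?_
        have hprodx : Measurable fun vw : (Fin n → ℝ) × (Fin n → ℝ) => ∏ p : Fin n × Fin n,
            κ (a x, b (a x) (vw.1 p.1), c (a x) (vw.2 p.2)) (s p) :=
          hprod.comp measurable_prodMk_left
        have hmx := measurable_prodMk_left (x := x) hmm
        rw [Measure.prod_apply hmx, lintegral_prod _ hprodx.aemeasurable]
        refine lintegral_congr fun v => ?_
        rw [Measure.prod_apply (measurable_prodMk_left (x := v) hmx)]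
        refine lintegral_congr fun w => ?_
        simp only [← hfκ]
        rw [← pi_preimage_eq_prod_map (fun _ => hfx _) hs]
        congr 1

end Coding
/-- **Aldous–Hoover representation theorem for separately exchangeable arrays.**
An array `X` with values in a Polish space is separately exchangeable if and only if there is a
measurable function `H : [0,1]⁴ → 𝕏` such that `X` can be coded by i.i.d. Uniform(0,1) random
variables `U; U_i; V_j; U_{i,j}` with representing function `H`, i.e.
`[X_{i,j}] =d [H(U, U_i, V_j, U_{i,j})]` (equality in distribution being expressed through all
the finite-dimensional sub-arrays). -/
theorem statement15
    {Ω 𝕏 : Type*} [MeasurableSpace Ω] [MeasurableSpace 𝕏] [TopologicalSpace 𝕏]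
    [PolishSpace 𝕏] [BorelSpace 𝕏]
    (μ : Measure Ω) [IsProbabilityMeasure μ]
    (X : ℕ → ℕ → Ω → 𝕏) (hX : ∀ i j, Measurable (X i j)) :
    SeparatelyExchangeable μ X ↔
      ∃ H : ℝ → ℝ → ℝ → ℝ → 𝕏,
        Measurable (fun q : ℝ × ℝ × ℝ × ℝ => H q.1 q.2.1 q.2.2.1 q.2.2.2) ∧
        ∀ n : ℕ,
          Measure.map (fun ω (p : Fin n × Fin n) => X p.1 p.2 ω) μ
            = Measure.map
                (fun (w : ℝ × (Fin n → ℝ) × (Fin n → ℝ) × (Fin n × Fin n → ℝ))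
                    (p : Fin n × Fin n) => H w.1 (w.2.1 p.1) (w.2.2.1 p.2) (w.2.2.2 p))
                (unif.prod ((Measure.pi fun _ : Fin n => unif).prod
                  ((Measure.pi fun _ : Fin n => unif).prod
                    (Measure.pi fun _ : Fin n × Fin n => unif)))) := by
  obtain ⟨ω⟩ := nonempty_of_isProbabilityMeasure μ
  have : Nonempty 𝕏 := ⟨X 0 0 ω⟩
  exact ⟨fun h => h.exists_coding hX, fun ⟨H, hH, h⟩ => separatelyExchangeable_of_coding hX hH h⟩
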